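/- arXiv:2512.07708 — 2 statements merged into one kernel-verified Lean document; each statement's English description precedes it below -/
import Mathlib

section
/- Let (H, n₂, n₃, σ₊, σ₋, ρ) be a solution of the Bianchi VI₀ (Sol) topo-GR system on an interval containing [t₀,∞), with Λ > 0, 1 + 3w ≥ 0, ρ(t) ≥ 0 for all t ≥ t₀, and H(t₀) > 0. Then H(t) ≥ √(Λ/3) for all t ≥ t₀, and as t → ∞: H(t) → √(Λ/3), σ₊(t) → 0, σ₋(t) → 0, ρ(t) → 0, and n₂(t) + n₃(t) → 0; i.e. a positive cosmological constant isotropizes Bianchi VI₀ solutions of topo-GR and drives the metric towards a maximal Sol metric. -/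
open Real Filter

/-- A function whose square is eventually dominated by a function tending to zero tends to zero. -/
theorem tendsto_zero_of_eventually_sq_le {α : Type*} {l : Filter α} {f g : α → ℝ}
    (hfg : ∀ᶠ x in l, f x ^ 2 ≤ g x) (hg : Tendsto g l (nhds 0)) : Tendsto f l (nhds 0) := by
  have hsqrt : Tendsto (fun x => √(g x)) l (nhds 0) := by
    simpa using hg.sqrt
  refine squeeze_zero_norm' (hfg.mono fun x hx => ?_) hsqrt
  rw [Real.norm_eq_abs]
  exact Real.abs_le_sqrt hx

/-- A continuous function on `[t₀, ∞)` without zeros which is positive at `t₀` stays positive. -/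
theorem pos_of_continuousOn_of_ne_zero {f : ℝ → ℝ} {t₀ : ℝ} (hf : ContinuousOn f (Set.Ici t₀))
    (hne : ∀ t ≥ t₀, f t ≠ 0) (h₀ : 0 < f t₀) : ∀ t ≥ t₀, 0 < f t := by
  intro t ht
  by_contra! hneg
  obtain ⟨x, hx, hfx⟩ := intermediate_value_Icc' ht (hf.mono Set.Icc_subset_Ici_self) ⟨hneg, h₀.le⟩
  exact hne x hx.1 hfx

/-- Exponential decay: a nonnegative `u` with `u' ≤ -c u` on `[t₀, ∞)`, `c > 0`, tends to zero. -/
theorem tendsto_zero_of_hasDerivAt_le_neg_mul {u u' : ℝ → ℝ} {t₀ c : ℝ} (hc : 0 < c)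
    (hu : ∀ t ≥ t₀, HasDerivAt u (u' t) t) (hle : ∀ t ≥ t₀, u' t ≤ -c * u t)
    (hnn : ∀ t ≥ t₀, 0 ≤ u t) : Tendsto u atTop (nhds 0) := by
  have hder : ∀ t ≥ t₀, HasDerivAt (fun t => u t * exp (c * t))
      (u' t * exp (c * t) + u t * (exp (c * t) * (c * 1))) t := fun t ht =>
    (hu t ht).mul ((hasDerivAt_id t).const_mul c).exp
  have hanti : AntitoneOn (fun t => u t * exp (c * t)) (Set.Ici t₀) := by
    refine antitoneOn_of_deriv_nonpos (convex_Ici t₀)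
      (fun t ht => (hder t ht).continuousAt.continuousWithinAt)
      (fun t ht => (hder t (interior_subset ht)).differentiableAt.differentiableWithinAt)
      fun t ht => ?_
    rw [(hder t (interior_subset ht)).deriv]
    nlinarith [hle t (interior_subset ht), exp_pos (c * t)]
  have hexp : Tendsto (fun t => u t₀ * exp (c * t₀) * exp (-(c * t))) atTop (nhds 0) := by
    simpa using (tendsto_exp_neg_atTop_nhds_zero.comp
      (tendsto_id.const_mul_atTop hc)).const_mul (u t₀ * exp (c * t₀))
  refine squeeze_zero' ((eventually_ge_atTop t₀).mono hnn)
    ((eventually_ge_atTop t₀).mono fun t ht => ?_) hexp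
  rw [exp_neg, ← div_eq_mul_inv, le_div_iff₀ (exp_pos _)]
  exact hanti Set.self_mem_Ici ht ht

/-- Isotropization of Bianchi VI₀ (Sol) solutions of topo-GR by a positive
cosmological constant: for a solution of the Bianchi VI₀ topo-GR system on
`[t₀,∞)` with `Λ > 0`, `1 + 3w ≥ 0`, `ρ ≥ 0` and `H(t₀) > 0`, one has
`H(t) ≥ √(Λ/3)` for all `t ≥ t₀`, and as `t → ∞`: `H → √(Λ/3)`, `σ₊ → 0`,
`σ₋ → 0`, `ρ → 0`, and `n₂ + n₃ → 0` (the metric is driven towards a maximal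
Sol metric). -/
theorem topoGR_BianchiVI0_isotropization
    (κ Λ w t₀ : ℝ) (hκ : 0 < κ) (hΛ : 0 < Λ) (hw : 0 ≤ 1 + 3 * w)
    (H n₂ n₃ σp σm ρ : ℝ → ℝ)
    (hHam : ∀ t ≥ t₀, (H t) ^ 2 = (σp t) ^ 2 + (σm t) ^ 2
      + (1 / 12) * (n₂ t + n₃ t) ^ 2 + (κ * ρ t + Λ) / 3)
    (hRay : ∀ t ≥ t₀, HasDerivAt H
      (-(H t) ^ 2 - 2 * ((σp t) ^ 2 + (σm t) ^ 2)
        - κ * (1 + 3 * w) * ρ t / 6 + Λ / 3) t)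
    (hn₂ : ∀ t ≥ t₀, HasDerivAt n₂
      (-(n₂ t) * (H t - 2 * σp t - 2 * Real.sqrt 3 * σm t)) t)
    (hn₃ : ∀ t ≥ t₀, HasDerivAt n₃
      (-(n₃ t) * (H t - 2 * σp t + 2 * Real.sqrt 3 * σm t)) t)
    (hσp : ∀ t ≥ t₀, HasDerivAt σp
      (-3 * H t * σp t - (1 / 6) * (n₂ t + n₃ t) ^ 2) t)
    (hσm : ∀ t ≥ t₀, HasDerivAt σm
      (-3 * H t * σm t - (1 / (2 * Real.sqrt 3)) * ((n₂ t) ^ 2 - (n₃ t) ^ 2)) t)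
    (hρ : ∀ t ≥ t₀, HasDerivAt ρ (-3 * (1 + w) * H t * ρ t) t)
    (hρnn : ∀ t ≥ t₀, 0 ≤ ρ t) (hH₀ : 0 < H t₀) :
    (∀ t ≥ t₀, Real.sqrt (Λ / 3) ≤ H t) ∧
    Tendsto H atTop (nhds (Real.sqrt (Λ / 3))) ∧
    Tendsto σp atTop (nhds 0) ∧
    Tendsto σm atTop (nhds 0) ∧
    Tendsto ρ atTop (nhds 0) ∧
    Tendsto (fun t => n₂ t + n₃ t) atTop (nhds 0) := by
  set s := √(Λ / 3)
  have hs_pos : 0 < s := Real.sqrt_pos.2 (by positivity)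
  have hs_sq : s ^ 2 = Λ / 3 := Real.sq_sqrt (by positivity)
  have hκρ : ∀ t ≥ t₀, 0 ≤ κ * ρ t := fun t ht => mul_nonneg hκ.le (hρnn t ht)
  have hH_pos : ∀ t ≥ t₀, 0 < H t := by
    refine pos_of_continuousOn_of_ne_zero
      (fun t ht => (hRay t ht).continuousAt.continuousWithinAt) (fun t ht h0 => ?_) hH₀
    have := hHam t ht
    rw [h0] at this
    nlinarith [hκρ t ht, sq_nonneg (σp t), sq_nonneg (σm t), sq_nonneg (n₂ t + n₃ t)]
  have hH_ge : ∀ t ≥ t₀, s ≤ H t := fun t ht => by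
    refine Real.sqrt_le_iff.2 ⟨(hH_pos t ht).le, ?_⟩
    linarith [hHam t ht, hκρ t ht, sq_nonneg (σp t), sq_nonneg (σm t), sq_nonneg (n₂ t + n₃ t)]
  have hu : Tendsto (fun t => H t - s) atTop (nhds 0) := by
    refine tendsto_zero_of_hasDerivAt_le_neg_mul (c := 2 * s) (by positivity)
      (fun t ht => (hRay t ht).sub_const s) (fun t ht => ?_) (fun t ht => sub_nonneg.2 (hH_ge t ht))
    have := mul_nonneg hw (hκρ t ht)
    nlinarith [sq_nonneg (σp t), sq_nonneg (σm t), sq_nonneg (H t - s)]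
  have hH : Tendsto H atTop (nhds s) := by simpa using hu.add_const s
  have hF : Tendsto (fun t => H t ^ 2 - s ^ 2) atTop (nhds 0) :=
    tendsto_sub_nhds_zero_iff.2 (hH.pow 2)
  refine ⟨hH_ge, hH, ?_, ?_, ?_, ?_⟩
  · refine tendsto_zero_of_eventually_sq_le ((eventually_ge_atTop t₀).mono fun t ht => ?_) hF
    linarith [hHam t ht, hκρ t ht, sq_nonneg (σm t), sq_nonneg (n₂ t + n₃ t)]
  · refine tendsto_zero_of_eventually_sq_le ((eventually_ge_atTop t₀).mono fun t ht => ?_) hF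
    linarith [hHam t ht, hκρ t ht, sq_nonneg (σp t), sq_nonneg (n₂ t + n₃ t)]
  · have hF' : Tendsto (fun t => 3 * (H t ^ 2 - s ^ 2) / κ) atTop (nhds 0) := by
      simpa using (hF.const_mul 3).div_const κ
    refine squeeze_zero' ((eventually_ge_atTop t₀).mono hρnn)
      ((eventually_ge_atTop t₀).mono fun t ht => ?_) hF'
    rw [le_div_iff₀ hκ]
    linarith [hHam t ht, sq_nonneg (σp t), sq_nonneg (σm t), sq_nonneg (n₂ t + n₃ t)]
  · have hF' : Tendsto (fun t => 12 * (H t ^ 2 - s ^ 2)) atTop (nhds 0) := by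
      simpa using hF.const_mul 12
    refine tendsto_zero_of_eventually_sq_le ((eventually_ge_atTop t₀).mono fun t ht => ?_) hF'
    linarith [hHam t ht, hκρ t ht, sq_nonneg (σp t), sq_nonneg (σm t)]
end

section
/- Let (H, n₂, n₃, σ₊, σ₋, ρ) be a solution of the Bianchi VII₀ topo-GR system on an interval containing [t₀,∞), with Λ > 0, 1 + 3w ≥ 0, ρ(t) ≥ 0 for all t ≥ t₀, and H(t₀) > 0. Then H(t) ≥ √(Λ/3) for all t ≥ t₀, and as t → ∞: H(t) → √(Λ/3), σ₊(t) → 0, σ₋(t) → 0, ρ(t) → 0, and n₂(t) − n₃(t) → 0; i.e. a positive cosmological constant isotropizes Bianchi VII₀ solutions. -/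
open Real Filter

/-- A solution of the differential inequality `f' ≤ s² - f²` on `[t₀, ∞)` that stays above `s > 0`
tends to `s`. -/
theorem tendsto_of_hasDerivAt_le_sq_sub_sq {f f' : ℝ → ℝ} {s t₀ : ℝ} (hs : 0 < s)
    (hf : ∀ t ≥ t₀, HasDerivAt f (f' t) t) (hf' : ∀ t ≥ t₀, f' t ≤ s ^ 2 - f t ^ 2)
    (hsf : ∀ t ≥ t₀, s ≤ f t) : Tendsto f atTop (nhds s) := by
  have hderiv : ∀ t ≥ t₀, HasDerivAt (fun u => (f u - s) * exp (2 * s * u))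
      ((f' t + 2 * s * (f t - s)) * exp (2 * s * t)) t := by
    intro t ht
    have hexp : HasDerivAt (fun u => exp (2 * s * u)) (exp (2 * s * t) * (2 * s)) t := by
      simpa using ((hasDerivAt_id t).const_mul (2 * s)).exp
    exact (((hf t ht).sub_const s).mul hexp).congr_deriv (by ring)
  have hanti : AntitoneOn (fun u => (f u - s) * exp (2 * s * u)) (Set.Ici t₀) := by
    refine antitoneOn_of_hasDerivWithinAt_nonpos (convex_Ici t₀)
      (fun t ht => (hderiv t ht).continuousAt.continuousWithinAt)
      (fun t ht => (hderiv t (interior_subset ht)).hasDerivWithinAt) fun t ht => ?_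
    have ht : t₀ ≤ t := interior_subset ht
    refine mul_nonpos_of_nonpos_of_nonneg ?_ (exp_pos _).le
    nlinarith [hf' t ht, sq_nonneg (f t - s)]
  set C := (f t₀ - s) * exp (2 * s * t₀)
  have hlim : Tendsto (fun t => s + C * exp (-(2 * s * t))) atTop (nhds s) := by
    have hexp : Tendsto (fun t => exp (-(2 * s * t))) atTop (nhds 0) :=
      tendsto_exp_neg_atTop_nhds_zero.comp (tendsto_id.const_mul_atTop (by positivity))
    simpa using (hexp.const_mul C).const_add s
  refine tendsto_of_tendsto_of_tendsto_of_le_of_le' tendsto_const_nhds hlim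
    ((eventually_ge_atTop t₀).mono hsf) ((eventually_ge_atTop t₀).mono fun t ht => ?_)
  have h : (f t - s) * exp (2 * s * t) ≤ C := hanti Set.self_mem_Ici ht ht
  have h' := mul_le_mul_of_nonneg_right h (exp_pos (-(2 * s * t))).le
  rw [mul_assoc, ← exp_add, add_neg_cancel, exp_zero, mul_one] at h'
  linarith

/-- A function whose square is eventually bounded by a null function tends to zero. -/
theorem tendsto_zero_of_sq_le {f g : ℝ → ℝ} {l : Filter ℝ} (hg : Tendsto g l (nhds 0))
    (hfg : ∀ᶠ t in l, f t ^ 2 ≤ g t) : Tendsto f l (nhds 0) := by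
  have hsqrt : Tendsto (fun t => √(g t)) l (nhds 0) := by
    simpa using hg.sqrt
  exact squeeze_zero_norm' (hfg.mono fun t ht => abs_le_sqrt ht) hsqrt

/-- Isotropization of Bianchi VII₀ solutions of topo-GR by a positive
cosmological constant: for a solution of the Bianchi VII₀ topo-GR system on
`[t₀,∞)` with `Λ > 0`, `1 + 3w ≥ 0`, `ρ ≥ 0` and `H(t₀) > 0`, one has
`H(t) ≥ √(Λ/3)` for all `t ≥ t₀`, and as `t → ∞`: `H → √(Λ/3)`, `σ₊ → 0`,
`σ₋ → 0`, `ρ → 0`, and `n₂ − n₃ → 0`. -/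
theorem topoGR_BianchiVII0_isotropization
    (κ Λ w t₀ : ℝ) (hκ : 0 < κ) (hΛ : 0 < Λ) (hw : 0 ≤ 1 + 3 * w)
    (H n₂ n₃ σp σm ρ : ℝ → ℝ)
    (hHam : ∀ t ≥ t₀, (H t) ^ 2 = (σp t) ^ 2 + (σm t) ^ 2
      + (1 / 12) * (n₂ t - n₃ t) ^ 2 + (κ * ρ t + Λ) / 3)
    (hRay : ∀ t ≥ t₀, HasDerivAt H
      (-(H t) ^ 2 - 2 * ((σp t) ^ 2 + (σm t) ^ 2)
        - κ * (1 + 3 * w) * ρ t / 6 + Λ / 3) t)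
    (hn₂ : ∀ t ≥ t₀, HasDerivAt n₂
      (-(n₂ t) * (H t - 2 * σp t - 2 * Real.sqrt 3 * σm t)) t)
    (hn₃ : ∀ t ≥ t₀, HasDerivAt n₃
      (-(n₃ t) * (H t - 2 * σp t + 2 * Real.sqrt 3 * σm t)) t)
    (hσp : ∀ t ≥ t₀, HasDerivAt σp
      (-3 * H t * σp t - (1 / 6) * (n₂ t - n₃ t) ^ 2) t)
    (hσm : ∀ t ≥ t₀, HasDerivAt σm
      (-3 * H t * σm t + (1 / (2 * Real.sqrt 3)) * ((n₃ t) ^ 2 - (n₂ t) ^ 2)) t)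
    (hρ : ∀ t ≥ t₀, HasDerivAt ρ (-3 * (1 + w) * H t * ρ t) t)
    (hρnn : ∀ t ≥ t₀, 0 ≤ ρ t) (hH₀ : 0 < H t₀) :
    (∀ t ≥ t₀, Real.sqrt (Λ / 3) ≤ H t) ∧
    Tendsto H atTop (nhds (Real.sqrt (Λ / 3))) ∧
    Tendsto σp atTop (nhds 0) ∧
    Tendsto σm atTop (nhds 0) ∧
    Tendsto ρ atTop (nhds 0) ∧
    Tendsto (fun t => n₂ t - n₃ t) atTop (nhds 0) := by
  set s := Real.sqrt (Λ / 3)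
  have hs : 0 < s := Real.sqrt_pos.2 (by positivity)
  have hs2 : s ^ 2 = Λ / 3 := Real.sq_sqrt (by positivity)
  have hκρ : ∀ t ≥ t₀, 0 ≤ κ * ρ t := fun t ht => mul_nonneg hκ.le (hρnn t ht)
  have hHsq : ∀ t ≥ t₀, s ^ 2 ≤ H t ^ 2 := by
    intro t ht
    linarith [hHam t ht, hκρ t ht, sq_nonneg (σp t), sq_nonneg (σm t), sq_nonneg (n₂ t - n₃ t)]
  have hHpos : ∀ t ≥ t₀, 0 < H t := by
    intro t ht
    by_contra! hneg
    obtain ⟨u, hu, hHu⟩ := intermediate_value_Icc' ht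
      (fun u hu => (hRay u hu.1).continuousAt.continuousWithinAt) ⟨hneg, hH₀.le⟩
    have := hHsq u hu.1
    rw [hHu] at this
    nlinarith
  have hsH : ∀ t ≥ t₀, s ≤ H t := fun t ht =>
    le_of_sq_le_sq (hHsq t ht) (hHpos t ht).le
  have hH : Tendsto H atTop (nhds s) := by
    refine tendsto_of_hasDerivAt_le_sq_sub_sq hs hRay (fun t ht => ?_) hsH
    nlinarith [mul_nonneg hw (hκρ t ht), sq_nonneg (σp t), sq_nonneg (σm t)]
  have hgap : Tendsto (fun t => H t ^ 2 - s ^ 2) atTop (nhds 0) := by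
    have h := (hH.pow 2).sub_const (s ^ 2)
    rwa [sub_self] at h
  have hbound : ∀ᶠ t in atTop, σp t ^ 2 ≤ H t ^ 2 - s ^ 2 ∧ σm t ^ 2 ≤ H t ^ 2 - s ^ 2 ∧
      κ * ρ t ≤ 3 * (H t ^ 2 - s ^ 2) ∧ (n₂ t - n₃ t) ^ 2 ≤ 12 * (H t ^ 2 - s ^ 2) := by
    filter_upwards [eventually_ge_atTop t₀] with t ht
    have h := hHam t ht
    have hρt := hκρ t ht
    have hp := sq_nonneg (σp t)
    have hm := sq_nonneg (σm t)
    have hn := sq_nonneg (n₂ t - n₃ t)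
    refine ⟨?_, ?_, ?_, ?_⟩ <;> linarith
  refine ⟨hsH, hH, tendsto_zero_of_sq_le hgap (hbound.mono fun t h => h.1),
    tendsto_zero_of_sq_le hgap (hbound.mono fun t h => h.2.1), ?_,
    tendsto_zero_of_sq_le (by simpa using hgap.const_mul 12) (hbound.mono fun t h => h.2.2.2)⟩
  have hlim : Tendsto (fun t => 3 * (H t ^ 2 - s ^ 2) / κ) atTop (nhds 0) := by
    simpa using (hgap.const_mul 3).div_const κ
  refine squeeze_zero' ((eventually_ge_atTop t₀).mono hρnn) (hbound.mono fun t h => ?_) hlim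
  rw [le_div_iff₀ hκ, mul_comm]
  exact h.2.2.1
end
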